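/- Let b > 0 and let (b_j)_{j≥1} be a nonincreasing summable sequence of nonnegative reals with b_1 + b_2 ≤ b, ∑_j b_j ≤ 3b and ∑_j b_j² < b². Define cB(a,k) := a · min{d ∈ ℕ : d² + 3d ≥ 2k} for a ≥ 0 and k ∈ ℕ, and define c_k := inf over finitely supported functions κ : ℕ → ℕ of [cB(b, k + ∑_j κ(j)) − ∑_j cB(b_j, κ(j))]. Set Vol := b² − ∑_j b_j² and Per := 3b − ∑_j b_j. Then liminf_{k→∞} (c_k − √(2k·Vol)) ≥ −Per/2. -/

import Mathlib

open Filter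

/-- The `k`-th ECH capacity of the ball `B(a)`: `cB a k = a * min {d ∈ ℕ | d² + 3d ≥ 2k}`. -/
noncomputable def cB (a : ℝ) (k : ℕ) : ℝ :=
  a * (sInf {d : ℕ | 2 * k ≤ d ^ 2 + 3 * d} : ℕ)

/-- The `k`-th ECH capacity of the convex toric domain with negative weight data
`(b; (bj j))`: the infimum over finitely supported `κ : ℕ → ℕ` of
`cB b (k + ∑ κ j) − ∑ cB (bj j) (κ j)`. -/
noncomputable def toricCap (b : ℝ) (bj : ℕ → ℝ) (k : ℕ) : ℝ :=
  ⨅ κ : ℕ →₀ ℕ,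
    (cB b (k + ∑ j ∈ κ.support, κ j) - ∑ j ∈ κ.support, cB (bj j) (κ j))

/-- The least `d` with `2 * k ≤ d ^ 2 + 3 * d`, so that `cB a k = a * ballIndex k`. -/
noncomputable def ballIndex (k : ℕ) : ℕ :=
  sInf {d : ℕ | 2 * k ≤ d ^ 2 + 3 * d}

theorem cB_eq_mul_ballIndex (a : ℝ) (k : ℕ) : cB a k = a * ballIndex k := rfl

theorem two_mul_le_ballIndex (k : ℕ) : 2 * k ≤ ballIndex k ^ 2 + 3 * ballIndex k :=
  Nat.sInf_mem (s := {d : ℕ | 2 * k ≤ d ^ 2 + 3 * d})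
    ⟨k, by simp only [Set.mem_ofPred_eq]; nlinarith⟩

theorem ballIndex_sq_add_le (k : ℕ) : ballIndex k ^ 2 + ballIndex k ≤ 2 * k := by
  obtain h | ⟨m, h⟩ : ballIndex k = 0 ∨ ∃ m, ballIndex k = m + 1 := by
    cases ballIndex k <;> simp
  · simp [h]
  · have hm : m ∉ {d : ℕ | 2 * k ≤ d ^ 2 + 3 * d} :=
      Nat.notMem_of_lt_sInf (by change m < ballIndex k; omega)
    simp only [Set.mem_ofPred_eq, not_le] at hm
    obtain ⟨c, hc⟩ := (Nat.even_mul_succ_self m).two_dvd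
    rw [h]
    have h1 : m ^ 2 + 3 * m = 2 * (c + m) := by nlinarith
    have h2 : (m + 1) ^ 2 + (m + 1) = 2 * (c + m + 1) := by nlinarith
    omega

theorem ballIndex_zero : ballIndex 0 = 0 := by
  have := ballIndex_sq_add_le 0
  omega

/-- The reversed Cauchy–Schwarz inequality for timelike vectors in a Lorentzian space. -/
theorem sum_mul_add_sqrt_le {ι : Type*} (s : Finset ι) (f g : ι → ℝ) {b d v q : ℝ}
    (hb : 0 ≤ b) (hd : 0 ≤ d) (hv : 0 ≤ v) (hq : 0 ≤ q)
    (hf : v + ∑ i ∈ s, f i ^ 2 ≤ b ^ 2) (hg : q + ∑ i ∈ s, g i ^ 2 ≤ d ^ 2) :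
    ∑ i ∈ s, f i * g i + √(v * q) ≤ b * d := by
  have hcs := Finset.sum_mul_sq_le_sq_mul_sq s f g
  have hF : 0 ≤ ∑ i ∈ s, f i ^ 2 := Finset.sum_nonneg fun i _ => sq_nonneg _
  have hG : 0 ≤ ∑ i ∈ s, g i ^ 2 := Finset.sum_nonneg fun i _ => sq_nonneg _
  set F := ∑ i ∈ s, f i ^ 2
  set G := ∑ i ∈ s, g i ^ 2
  set P := ∑ i ∈ s, f i * g i
  have hs := Real.sq_sqrt (mul_nonneg hv hq)
  set r := √(v * q)
  have hcross : 2 * (P * r) ≤ F * q + G * v := by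
    refine abs_le_of_sq_le_sq' ?_ (by positivity) |>.2
    calc (2 * (P * r)) ^ 2 = 4 * (P ^ 2 * (v * q)) := by rw [← hs]; ring
      _ ≤ 4 * (F * G * (v * q)) := by gcongr
      _ ≤ (F * q + G * v) ^ 2 := by nlinarith [sq_nonneg (F * q - G * v)]
  refine abs_le_of_sq_le_sq' ?_ (by positivity) |>.2
  calc (P + r) ^ 2 = P ^ 2 + 2 * (P * r) + r ^ 2 := by ring
    _ ≤ F * G + (F * q + G * v) + v * q := by rw [hs]; gcongr
    _ = (v + F) * (q + G) := by ring
    _ ≤ b ^ 2 * d ^ 2 := by gcongr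
    _ = (b * d) ^ 2 := by ring

/-- The first `N` weights contribute their share of the affine perimeter, at the cost of
shifting the argument of the volume term by a constant depending on `N`. -/
theorem sqrt_sub_le_toricCap {b : ℝ} (hb : 0 < b) {bj : ℕ → ℝ} {v : ℝ} (hv : 0 ≤ v)
    (hvol : ∀ s : Finset ℕ, v + ∑ j ∈ s, bj j ^ 2 ≤ b ^ 2) (N k : ℕ)
    (hk : (N : ℝ) / 4 ≤ 2 * k) :
    √(v * (2 * k - N / 4)) - (3 * b - ∑ j ∈ Finset.range N, bj j) / 2 ≤ toricCap b bj k := by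
  refine le_ciInf fun κ => ?_
  set S := κ.support ∪ Finset.range N
  have hsub : Finset.range N ⊆ S := Finset.subset_union_right
  have hzero : ∀ j ∈ S, j ∉ κ.support → κ j = 0 := fun j _ hj => by simpa using hj
  have hκ : ∑ j ∈ κ.support, κ j = ∑ j ∈ S, κ j :=
    Finset.sum_subset Finset.subset_union_left hzero
  have hcap : ∑ j ∈ κ.support, cB (bj j) (κ j) = ∑ j ∈ S, bj j * ballIndex (κ j) := by
    simp only [cB_eq_mul_ballIndex]
    refine Finset.sum_subset Finset.subset_union_left fun j hjS hj => ?_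
    simp [hzero j hjS hj, ballIndex_zero]
  have hshift : ∀ f : ℕ → ℝ,
      ∑ j ∈ S, (if j ∈ Finset.range N then f j else 0) = ∑ j ∈ Finset.range N, f j := fun f => by
    rw [Finset.sum_ite_mem, Finset.inter_eq_right.2 hsub]
  rw [hκ, hcap, cB_eq_mul_ballIndex]
  set d := ballIndex (k + ∑ j ∈ S, κ j)
  have hd : 2 * ((k : ℝ) + ∑ j ∈ S, (κ j : ℝ)) ≤ (d : ℝ) ^ 2 + 3 * d := by
    exact_mod_cast two_mul_le_ballIndex (k + ∑ j ∈ S, κ j)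
  let g : ℕ → ℝ := fun j => ballIndex (κ j) + if j ∈ Finset.range N then 1 / 2 else 0
  have hg : ∑ j ∈ S, g j ^ 2 ≤ 2 * ∑ j ∈ S, (κ j : ℝ) + N / 4 := by
    have hN : ∑ j ∈ S, (if j ∈ Finset.range N then (1 / 4 : ℝ) else 0) = N / 4 := by
      rw [hshift]; simp; ring
    rw [Finset.mul_sum, ← hN, ← Finset.sum_add_distrib]
    refine Finset.sum_le_sum fun j _ => ?_
    have hj : (ballIndex (κ j) : ℝ) ^ 2 + ballIndex (κ j) ≤ 2 * κ j := by
      exact_mod_cast ballIndex_sq_add_le (κ j)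
    have hj0 : (0 : ℝ) ≤ ballIndex (κ j) := Nat.cast_nonneg _
    simp only [g]
    split_ifs <;> nlinarith
  have hfg : ∑ j ∈ S, bj j * g j =
      ∑ j ∈ S, bj j * ballIndex (κ j) + (∑ j ∈ Finset.range N, bj j) / 2 := by
    have h : (∑ j ∈ Finset.range N, bj j) / 2 =
        ∑ j ∈ S, (if j ∈ Finset.range N then bj j / 2 else 0) := by
      rw [hshift, Finset.sum_div]
    rw [h, ← Finset.sum_add_distrib]
    refine Finset.sum_congr rfl fun j _ => ?_
    simp only [g]
    split_ifs <;> ring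
  have key := sum_mul_add_sqrt_le S bj g (b := b) (d := d + 3 / 2) (q := 2 * k - N / 4)
    hb.le (by positivity) hv (by linarith) (hvol S) (by nlinarith)
  rw [hfg] at key
  linarith

theorem eventually_sqrt_le_sqrt_sub_add {v : ℝ} (hv : 0 < v) (c : ℝ) {ε : ℝ} (hε : 0 < ε) :
    ∀ᶠ k : ℕ in atTop, √(2 * k * v) ≤ √(v * (2 * k - c)) + ε := by
  have hlim : Tendsto (fun k : ℕ => √(v * (2 * k - c))) atTop atTop := by
    refine Real.tendsto_sqrt_atTop.comp (Tendsto.const_mul_atTop hv ?_)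
    exact tendsto_atTop_add_const_right _ _
      (tendsto_natCast_atTop_atTop.const_mul_atTop two_pos)
  filter_upwards [hlim.eventually_ge_atTop (v * c / (2 * ε)), hlim.eventually_gt_atTop 0]
    with k hk hpos
  have hsq := Real.sq_sqrt (Real.sqrt_pos.1 hpos).le
  rw [div_le_iff₀ (by positivity)] at hk
  refine Real.sqrt_le_iff.2 ⟨by positivity, ?_⟩
  nlinarith

/-- `liminf (c_k − √(2k·Vol)) ≥ −Per/2` where `Vol = b² − ∑ bj²`
and `Per = 3b − ∑ bj`. -/
theorem stmt_5 (b : ℝ) (hb : 0 < b) (bj : ℕ → ℝ)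
    (hnonneg : ∀ j, 0 ≤ bj j) (hmono : Antitone bj) (hsum : Summable bj)
    (h12 : bj 0 + bj 1 ≤ b) (h3b : ∑' j, bj j ≤ 3 * b)
    (hsq : ∑' j, (bj j) ^ 2 < b ^ 2) :
    Filter.liminf
        (fun k : ℕ => toricCap b bj k -
          Real.sqrt (2 * k * (b ^ 2 - ∑' j, (bj j) ^ 2)))
        Filter.atTop
      ≥ -(3 * b - ∑' j, bj j) / 2 := by
  have hsummable : Summable fun j => bj j ^ 2 := by
    refine Summable.of_nonneg_of_le (fun j => sq_nonneg _) (fun j => ?_) (hsum.mul_left (bj 0))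
    rw [sq]
    exact mul_le_mul_of_nonneg_right (hmono (Nat.zero_le j)) (hnonneg j)
  have hvol : ∀ s : Finset ℕ, (b ^ 2 - ∑' j, bj j ^ 2) + ∑ j ∈ s, bj j ^ 2 ≤ b ^ 2 := fun s => by
    have := hsummable.sum_le_tsum s fun j _ => sq_nonneg (bj j)
    linarith
  have hv : 0 < b ^ 2 - ∑' j, bj j ^ 2 := by linarith
  set v := b ^ 2 - ∑' j, bj j ^ 2
  rw [ge_iff_le, Filter.liminf_eq]
  by_cases hbdd : BddAbove {a | ∀ᶠ k : ℕ in atTop, a ≤ toricCap b bj k - √(2 * k * v)}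
  swap
  · rw [Real.sSup_of_not_bddAbove hbdd]
    linarith
  refine le_of_forall_pos_le_add fun ε hε => ?_
  suffices h : ∀ᶠ k : ℕ in atTop,
      -(3 * b - ∑' j, bj j) / 2 - ε ≤ toricCap b bj k - √(2 * k * v) by
    linarith [le_csSup hbdd h]
  obtain ⟨N, hN⟩ := (hsum.hasSum.tendsto_sum_nat.eventually_const_lt
    (sub_lt_self (∑' j, bj j) hε)).exists
  have hlarge : ∀ᶠ k : ℕ in atTop, (N : ℝ) / 4 ≤ 2 * k :=
    (tendsto_natCast_atTop_atTop.const_mul_atTop two_pos).eventually_ge_atTop _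
  filter_upwards [eventually_sqrt_le_sqrt_sub_add hv (N / 4) (half_pos hε), hlarge] with k hk hNk
  have := sqrt_sub_le_toricCap hb hv.le hvol N k hNk
  linarith
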